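/- Define V₀(x) = (cos(πx)/π)²·(x·ψ'(1/2 - x) + 1) for x ∈ ℝ (extended continuously at the singularities of ψ'). Then V₀(x) ≥ max(0, x) for all real x, and 2·∫_ℝ (V₀(x) - max(0,x)) dx = 1/12. -/

import Mathlib

open Real MeasureTheory Classical

/-- The trigamma function: `ψ'(x) = ∑_{n ≥ 0} 1/(n+x)²` (for `x` not a
nonpositive integer). -/
noncomputable def trigamma (x : ℝ) : ℝ := ∑' n : ℕ, 1 / ((n : ℝ) + x)^2

/-- Littmann's extremal majorant `V₀(x) = (cos(πx)/π)² (x ψ'(1/2 - x) + 1)` of the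
ramp function, extended continuously at the singularities `x = m + 1/2`, `m ∈ ℕ`,
of `ψ'(1/2 - x)` (where the continuous extension takes the value `x`). -/
noncomputable def V₀ (x : ℝ) : ℝ :=
  if ∃ m : ℕ, x = m + 1/2 then x
  else (Real.cos (π * x) / π)^2 * (x * trigamma (1/2 - x) + 1)

lemma tg_summable (a : ℝ) : Summable (fun n : ℕ => 1 / ((n : ℝ) + a)^2) := by
  have h := (Real.summable_one_div_nat_add_rpow a 2).2 (by norm_num)
  refine h.congr fun n => ?_
  rw [show (2 : ℝ) = ((2 : ℕ) : ℝ) by norm_num, Real.rpow_natCast, sq_abs]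

lemma tg_hasSum (a : ℝ) : HasSum (fun n : ℕ => 1 / ((n : ℝ) + a)^2) (trigamma a) :=
  (tg_summable a).hasSum

lemma tg_shift (a : ℝ) : trigamma a = 1 / a^2 + trigamma (a + 1) := by
  unfold trigamma
  rw [(tg_summable a).tsum_eq_zero_add]
  congr 1
  · simp
  · refine tsum_congr fun n => ?_
    push_cast
    ring_nf

lemma tele_hasSum (L : ℝ → ℝ) (hL : Filter.Tendsto L Filter.atTop (nhds 0)) (a : ℝ)
    (hpos : ∀ n : ℕ, 0 ≤ L (n + a) - L (n + a + 1)) :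
    HasSum (fun n : ℕ => L (n + a) - L (n + a + 1)) (L a) := by
  rw [hasSum_iff_tendsto_nat_of_nonneg hpos]
  have h1 : ∀ N : ℕ, ∑ i ∈ Finset.range N, (L (i + a) - L (i + a + 1)) = L a - L (N + a) := by
    intro N
    induction N with
    | zero => simp
    | succ k ih => rw [Finset.sum_range_succ, ih]; push_cast; ring_nf
  simp_rw [h1]
  have h2 : Filter.Tendsto (fun N : ℕ => (N : ℝ) + a) Filter.atTop Filter.atTop :=
    Filter.tendsto_atTop_add_const_right _ _ tendsto_natCast_atTop_atTop
  simpa using (tendsto_const_nhds (x := L a)).sub (hL.comp h2)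

lemma tg_upper {y : ℝ} (hy : 0 < y) : trigamma (1/2 + y) ≤ 1 / y := by
  have key : ∀ t : ℝ, 0 < t → 1 / (t + 1/2)^2 ≤ 1 / t - 1 / (t + 1) := by
    intro t ht
    rw [div_sub_div _ _ (by positivity) (by positivity), div_le_div_iff₀ (by positivity) (by positivity)]
    nlinarith
  have hk : ∀ n : ℕ, 0 < (n : ℝ) + y := fun n => by positivity
  have h := tele_hasSum (fun t => 1 / t) (by simpa using tendsto_inv_atTop_zero) y
    (fun n => le_trans (by positivity) (key _ (hk n)))
  refine hasSum_le (fun n => ?_) (tg_hasSum (1/2 + y)) h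
  have := key _ (hk n)
  rwa [show (n : ℝ) + (1/2 + y) = n + y + 1/2 by ring]

lemma tg_lower {y : ℝ} (hy : 1 ≤ y) : y / (y^2 + 1/4) ≤ trigamma (1/2 + y) := by
  have key : ∀ t : ℝ, 1 ≤ t → t / (t^2 + 1/4) - (t + 1) / ((t + 1)^2 + 1/4) ≤ 1 / (t + 1/2)^2 := by
    intro t ht
    rw [div_sub_div _ _ (by positivity) (by positivity), div_le_div_iff₀ (by positivity) (by positivity)]
    nlinarith
  have key2 : ∀ t : ℝ, 1 ≤ t → 0 ≤ t / (t^2 + 1/4) - (t + 1) / ((t + 1)^2 + 1/4) := by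
    intro t ht
    rw [div_sub_div _ _ (by positivity) (by positivity)]
    apply div_nonneg _ (by positivity)
    nlinarith
  have hk : ∀ n : ℕ, 1 ≤ (n : ℝ) + y := fun n => by
    have : (0 : ℝ) ≤ n := by positivity
    linarith
  have hlim : Filter.Tendsto (fun t : ℝ => t / (t^2 + 1/4)) Filter.atTop (nhds 0) := by
    refine tendsto_of_tendsto_of_tendsto_of_le_of_le' tendsto_const_nhds tendsto_inv_atTop_zero ?_ ?_
    · filter_upwards [Filter.eventually_ge_atTop 1] with t ht
      positivity
    · filter_upwards [Filter.eventually_ge_atTop 1] with t ht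
      rw [inv_eq_one_div, div_le_div_iff₀ (by positivity) (by positivity)]
      nlinarith
  have h := tele_hasSum (fun t => t / (t^2 + 1/4)) hlim y (fun n => key2 _ (hk n))
  refine hasSum_le (fun n => ?_) h (tg_hasSum (1/2 + y))
  have := key _ (hk n)
  rwa [show (n : ℝ) + (1/2 + y) = n + y + 1/2 by ring]

lemma fcoeff (a : ℝ) (ha : Real.sin (π * a) ≠ 0) (n : ℤ) (han : a - n ≠ 0) :
    ‖fourierCoeffOn (zero_lt_one' ℝ) (fun x : ℝ => Complex.exp (2 * π * Complex.I * a * x)) n‖^2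
      = Real.sin (π * a)^2 / π^2 * (1 / (a - n)^2) := by
  rw [fourierCoeffOn_eq_integral]
  have h1 : ∀ x : ℝ, (fourier (-n) (x : AddCircle ((1 : ℝ) - 0))) • Complex.exp (2 * π * Complex.I * a * x)
      = Complex.exp ((2 * π * Complex.I * (a - n)) * x) := by
    intro x
    rw [fourier_coe_apply, smul_eq_mul, ← Complex.exp_add]
    congr 1
    push_cast
    ring
  simp_rw [h1]
  have hc : (2 * π * Complex.I * (a - n) : ℂ) ≠ 0 := by
    have : (a - n : ℂ) ≠ 0 := by exact_mod_cast han
    simp [Complex.I_ne_zero, Real.pi_ne_zero, this]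
  rw [integral_exp_mul_complex hc]
  have h2 : Complex.exp (2 * π * Complex.I * (a - n) * (1 : ℝ)) = Complex.exp (Complex.I * ((2 * π * a : ℝ) : ℂ)) := by
    rw [← Complex.exp_periodic.sub_int_mul_eq (x := Complex.I * ((2 * π * a : ℝ) : ℂ)) n]
    congr 1
    push_cast
    ring
  rw [h2]
  simp only [sub_zero, div_one, one_smul, Complex.ofReal_zero, mul_zero, Complex.exp_zero]
  rw [norm_div, Complex.norm_exp_I_mul_ofReal_sub_one]
  have h3 : ‖(2 * π * Complex.I * (a - n) : ℂ)‖ = 2 * π * |a - n| := by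
    rw [show (2 * π * Complex.I * (a - n) : ℂ) = ((2 * π * (a - n) : ℝ) : ℂ) * Complex.I by push_cast; ring]
    rw [norm_mul, Complex.norm_I, mul_one, Complex.norm_real, Real.norm_eq_abs, abs_mul,
      abs_of_pos (by positivity)]
  rw [h3, show 2 * π * a / 2 = π * a by ring, Real.norm_eq_abs, div_pow, mul_pow, sq_abs, sq_abs]
  field_simp

lemma refl_hasSum (a : ℝ) (ha : Real.sin (π * a) ≠ 0) :
    HasSum (fun n : ℤ => 1 / (a - n)^2) (π^2 / Real.sin (π * a)^2) := by
  have han : ∀ n : ℤ, a - n ≠ 0 := by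
    intro n h
    apply ha
    rw [show a = n by linarith, mul_comm]
    exact Real.sin_int_mul_pi n
  have hL2 : MemLp (fun x : ℝ => Complex.exp (2 * π * Complex.I * a * x)) 2
      (volume.restrict (Set.Ioc 0 1)) := by
    refine MemLp.of_bound (Continuous.aestronglyMeasurable (by fun_prop)) 1 ?_
    refine Filter.Eventually.of_forall fun x => ?_
    rw [show (2 * π * Complex.I * a * x : ℂ) = ((2 * π * a * x : ℝ) : ℂ) * Complex.I by push_cast; ring,
      Complex.norm_exp_ofReal_mul_I]
  have h := hasSum_sq_fourierCoeffOn (zero_lt_one' ℝ) hL2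
  have hn : ∀ x : ℝ, ‖Complex.exp (2 * π * Complex.I * a * x)‖ = 1 := by
    intro x
    rw [show (2 * π * Complex.I * a * x : ℂ) = ((2 * π * a * x : ℝ) : ℂ) * Complex.I by push_cast; ring,
      Complex.norm_exp_ofReal_mul_I]
  simp_rw [hn] at h
  have h' := h.mul_left (π^2 / Real.sin (π * a)^2)
  have e1 : (fun n : ℤ => 1 / (a - n)^2) = fun i : ℤ => π^2 / Real.sin (π * a)^2 *
      ‖fourierCoeffOn (zero_lt_one' ℝ) (fun x : ℝ => Complex.exp (2 * π * Complex.I * a * x)) i‖^2 := by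
    funext n
    rw [fcoeff a ha n (han n)]
    have := Real.pi_ne_zero
    have e2 : π^2 / Real.sin (π * a)^2 * (Real.sin (π * a)^2 / π^2) = 1 := by
      generalize Real.sin (π * a) = s at ha
      field_simp
    rw [← mul_assoc, e2, one_mul]
  rw [e1]
  simpa using h'

lemma tg_refl (x : ℝ) (hx : Real.cos (π * x) ≠ 0) :
    trigamma (1/2 - x) + trigamma (1/2 + x) = π^2 / Real.cos (π * x)^2 := by
  have hs : Real.sin (π * (1/2 + x)) = Real.cos (π * x) := by
    rw [show π * (1/2 + x) = π * x + π / 2 by ring, Real.sin_add_pi_div_two]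
  have h := refl_hasSum (1/2 + x) (by rwa [hs])
  rw [hs] at h
  have h2 : HasSum (fun n : ℤ => 1 / ((1/2 + x) - n)^2) (trigamma (1/2 - x - 1 + 1) + trigamma (1/2 + x)) := by
    rw [add_comm (trigamma _) (trigamma _)]
    have h3 : HasSum (fun n : ℤ => 1 / ((1/2 + x) + n)^2) (trigamma (1/2 + x) + trigamma (1/2 - x - 1 + 1)) := by
      refine HasSum.of_nat_of_neg_add_one ?_ ?_
      · convert tg_hasSum (1/2 + x) using 3
        push_cast; ring
      · convert tg_hasSum (1/2 - x - 1 + 1) using 3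
        push_cast; ring
    rw [← (Equiv.neg ℤ).hasSum_iff] at h3
    have e : (fun n : ℤ => 1 / ((1/2 + x) - n)^2) =
        (fun n : ℤ => 1 / ((1/2 + x) + (n : ℝ))^2) ∘ (Equiv.neg ℤ) := by
      funext n
      simp [sub_eq_add_neg]
    rw [e]
    exact h3
  rw [sub_add_cancel] at h2
  exact h2.unique h

/-- The excess on the half line. -/
noncomputable def gg (y : ℝ) : ℝ := 1 - y * trigamma (1/2 + y)

lemma gg_nonneg {y : ℝ} (hy : 0 ≤ y) : 0 ≤ gg y := by
  unfold gg
  rcases hy.eq_or_lt with rfl | hy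
  · simp
  · have := mul_le_mul_of_nonneg_left (tg_upper hy) hy.le
    rw [mul_one_div_cancel hy.ne'] at this
    linarith

lemma gg_partial {x : ℝ} (hx : 0 ≤ x) (M : ℕ) :
    ∑ m ∈ Finset.range M, gg (x + m) = M / 2 + 1/2 * (x - 1/2)^2 * trigamma (1/2 + x)
      - 1/2 * (x + M - 1/2)^2 * trigamma (1/2 + (x + M)) := by
  induction M with
  | zero => simp
  | succ k ih =>
    rw [Finset.sum_range_succ, ih]
    unfold gg
    have h := tg_shift (1/2 + (x + k))
    push_cast
    rw [show 1/2 + (x + ((k : ℝ) + 1)) = 1/2 + (x + k) + 1 by ring]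
    have h' : trigamma (1/2 + (x + k) + 1) = trigamma (1/2 + (x + k)) - 1 / (1/2 + (x + k))^2 := by
      linarith
    rw [h']
    have : 1/2 + (x + (k : ℝ)) ≠ 0 := by positivity
    have e : (1/2 + (x + (k : ℝ)))^2 * (1 / (1/2 + (x + k))^2) = 1 := by field_simp
    linear_combination (-1/2) * e

lemma gg_hasSum {x : ℝ} (hx : 0 ≤ x) :
    HasSum (fun m : ℕ => gg (x + m)) ((1 - x) / 2 + 1/2 * (x - 1/2)^2 * trigamma (1/2 + x)) := by
  rw [hasSum_iff_tendsto_nat_of_nonneg (fun m => gg_nonneg (by positivity))]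
  simp_rw [gg_partial hx]
  have hlim : Filter.Tendsto (fun y : ℝ => (y - 1/2)^2 * trigamma (1/2 + y) - y) Filter.atTop (nhds (-1)) := by
    have hi := tendsto_inv_atTop_zero (𝕜 := ℝ)
    refine tendsto_of_tendsto_of_tendsto_of_le_of_le' (g := fun y => -1 / (1 + 1/4 * y⁻¹^2))
      (h := fun y => -1 + 1/4 * y⁻¹) ?_ ?_ ?_ ?_
    · have : Filter.Tendsto (fun y : ℝ => -1 / (1 + 1/4 * y⁻¹^2)) Filter.atTop
          (nhds (-1 / (1 + 1/4 * 0^2))) :=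
        tendsto_const_nhds.div (tendsto_const_nhds.add (tendsto_const_nhds.mul (hi.pow 2))) (by norm_num)
      simpa using this
    · have := (tendsto_const_nhds (x := (-1 : ℝ))).add (hi.const_mul (1/4))
      rwa [mul_zero, add_zero] at this
    · filter_upwards [Filter.eventually_ge_atTop 1] with y hy
      have h := mul_le_mul_of_nonneg_left (tg_lower hy) (sq_nonneg (y - 1/2))
      have e : (-1 : ℝ) / (1 + 1/4 * y⁻¹^2) = (y - 1/2)^2 * (y / (y^2 + 1/4)) - y := by
        have : y ≠ 0 := by positivity
        field_simp
        ring
      linarith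
    · filter_upwards [Filter.eventually_ge_atTop 1] with y hy
      have h := mul_le_mul_of_nonneg_left (tg_upper (by linarith : 0 < y)) (sq_nonneg (y - 1/2))
      have e : -1 + 1/4 * y⁻¹ = (y - 1/2)^2 * (1 / y) - y := by
        have : y ≠ 0 := by positivity
        field_simp
        ring
      linarith
  have h2 : Filter.Tendsto (fun N : ℕ => x + (N : ℝ)) Filter.atTop Filter.atTop :=
    Filter.tendsto_atTop_add_const_left _ _ tendsto_natCast_atTop_atTop
  have h3 := (tendsto_const_nhds (x := 1/2 * (x - 1/2)^2 * trigamma (1/2 + x) - x / 2)).sub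
    ((hlim.comp h2).const_mul (1/2))
  convert h3 using 2
  · simp only [Function.comp]
    ring
  · ring

/-- The excess function. -/
noncomputable def FF (x : ℝ) : ℝ := (Real.cos (π * x) / π)^2 * gg |x|

lemma FF_nonneg (x : ℝ) : 0 ≤ FF x := mul_nonneg (sq_nonneg _) (gg_nonneg (abs_nonneg x))

lemma V_eq (x : ℝ) : V₀ x - max 0 x = FF x := by
  unfold V₀
  split_ifs with h
  · obtain ⟨m, rfl⟩ := h
    rw [max_eq_right (by positivity)]
    have : Real.cos (π * (m + 1/2)) = 0 := by
      rw [Real.cos_eq_zero_iff]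
      exact ⟨m, by push_cast; ring⟩
    rw [FF, this]; simp
  · unfold FF gg
    rcases le_or_gt x 0 with hx | hx
    · rw [max_eq_left hx, abs_of_nonpos hx, ← sub_eq_add_neg]
      ring
    · have hc : Real.cos (π * x) ≠ 0 := by
        intro hc
        rw [Real.cos_eq_zero_iff] at hc
        obtain ⟨k, hk⟩ := hc
        have hk' : x = k + 1/2 := by
          have : π * x = π * (k + 1/2) := by rw [hk]; ring
          exact mul_left_cancel₀ Real.pi_ne_zero this
        have hk0 : 0 ≤ k := by
          by_contra hneg
          have : k ≤ -1 := by omega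
          have : (k : ℝ) ≤ -1 := by exact_mod_cast this
          linarith
        lift k to ℕ using hk0
        exact h ⟨k, by simpa using hk'⟩
      have hr := tg_refl x hc
      rw [max_eq_right hx.le, abs_of_pos hx, show trigamma (1/2 - x) = π^2 / Real.cos (π * x)^2
        - trigamma (1/2 + x) by linarith]
      have := Real.pi_ne_zero
      field_simp
      ring

lemma cos_sq_int (x : ℝ) (n : ℤ) : Real.cos (π * (x + n))^2 = Real.cos (π * x)^2 := by
  rw [Real.cos_sq, Real.cos_sq, show 2 * (π * (x + n)) = 2 * (π * x) + n * (2 * π) by ring,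
    Real.cos_add_int_mul_two_pi]

lemma FF_hasSum {x : ℝ} (hx : x ∈ Set.Ioc (0 : ℝ) 1) :
    HasSum (fun n : ℤ => FF (x + n)) (1/2 * (x - 1/2)^2) := by
  have h1 := gg_hasSum hx.1.le
  have h2 := gg_hasSum (x := 1 - x) (by linarith [hx.2])
  have h3 : HasSum (fun n : ℤ => gg |x + n|)
      (((1 - x) / 2 + 1/2 * (x - 1/2)^2 * trigamma (1/2 + x)) +
      ((1 - (1 - x)) / 2 + 1/2 * (1 - x - 1/2)^2 * trigamma (1/2 + (1 - x)))) := by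
    refine HasSum.of_nat_of_neg_add_one (f := fun n : ℤ => gg |x + n|) ?_ ?_
    · convert h1 using 3 with n
      push_cast
      exact abs_of_nonneg (by linarith [hx.1, (Nat.cast_nonneg n : (0 : ℝ) ≤ n)])
    · convert h2 using 3 with n
      push_cast
      rw [abs_of_nonpos (by linarith [hx.2, (Nat.cast_nonneg n : (0 : ℝ) ≤ n)])]
      ring
  have h4 := h3.mul_left ((Real.cos (π * x) / π)^2)
  have e0 : (fun n : ℤ => FF (x + n)) = fun n : ℤ => (Real.cos (π * x) / π)^2 * gg |x + n| := by
    funext n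
    unfold FF
    rw [div_pow, cos_sq_int, div_pow]
  rw [e0]
  suffices hE : 1/2 * (x - 1/2)^2 = (Real.cos (π * x) / π)^2 *
      (((1 - x) / 2 + 1/2 * (x - 1/2)^2 * trigamma (1/2 + x)) +
      ((1 - (1 - x)) / 2 + 1/2 * (1 - x - 1/2)^2 * trigamma (1/2 + (1 - x)))) by
    rw [hE]
    exact h4
  · by_cases hc : Real.cos (π * x) = 0
    · have : x = 1/2 := by
        rw [Real.cos_eq_zero_iff] at hc
        obtain ⟨k, hk⟩ := hc
        have hk' : x = k + 1/2 := by
          have : π * x = π * (k + 1/2) := by rw [hk]; ring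
          exact mul_left_cancel₀ Real.pi_ne_zero this
        have a1 : (-1 : ℝ) < k := by linarith [hx.1]
        have a2 : (k : ℝ) < 1 := by linarith [hx.2]
        have a1' : -1 < k := by exact_mod_cast a1
        have a2' : k < 1 := by exact_mod_cast a2
        have : k = 0 := by omega
        rw [hk', this]; simp
      rw [hc, this]; simp
    · have hr := tg_refl x hc
      have hne : 1/2 - x ≠ 0 := by
        intro h0
        apply hc
        rw [show x = 1/2 by linarith, show π * (1/2) = π / 2 by ring, Real.cos_pi_div_two]
      have hs := tg_shift (1/2 - x)
      rw [show 1/2 + (1 - x) = 1/2 - x + 1 by ring,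
        show trigamma (1/2 - x + 1) = π^2 / Real.cos (π * x)^2 - trigamma (1/2 + x) - 1 / (1/2 - x)^2
          by linarith]
      have e : (1/2 - x)^2 * (1 / (1/2 - x)^2) = 1 := mul_one_div_cancel (pow_ne_zero 2 hne)
      have e2 : (Real.cos (π * x) / π)^2 * (π^2 / Real.cos (π * x)^2) = 1 := by
        have := Real.pi_ne_zero
        field_simp
      linear_combination (-1/2 * (x - 1/2)^2) * e2 + (1/2) * (Real.cos (π * x) / π)^2 * e

lemma tg_measurable : Measurable trigamma := by
  have : trigamma = fun x => (∑' n : ℕ, ENNReal.ofReal (1 / ((n : ℝ) + x)^2)).toReal := by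
    funext x
    rw [ENNReal.tsum_toReal_eq (fun n => ENNReal.ofReal_ne_top)]
    unfold trigamma
    refine tsum_congr fun n => ?_
    rw [ENNReal.toReal_ofReal (by positivity)]
  rw [this]
  refine (Measurable.ennreal_tsum fun n => ?_).ennreal_toReal
  fun_prop

lemma FF_measurable : Measurable FF := by
  unfold FF gg
  have := tg_measurable
  fun_prop

lemma FF_integral : ∫ x, FF x = 1/24 := by
  rw [integral_eq_lintegral_of_nonneg_ae (Filter.Eventually.of_forall FF_nonneg)
    FF_measurable.aestronglyMeasurable]
  have h1 : ∫⁻ x, ENNReal.ofReal (FF x) = ∑' n : ℤ, ∫⁻ x in Set.Ioc (0 : ℝ) 1, ENNReal.ofReal (FF (x + n)) := by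
    rw [← setLIntegral_univ, ← iUnion_Ioc_intCast ℝ, lintegral_iUnion (fun _ => measurableSet_Ioc)
      (Set.pairwise_disjoint_Ioc_intCast ℝ)]
    refine tsum_congr fun n => ?_
    have := (measurePreserving_add_right volume (n : ℝ)).setLIntegral_comp_emb
      (measurableEmbedding_addRight _) (fun x => ENNReal.ofReal (FF x)) (Set.Ioc 0 1)
    rw [this]
    congr 2
    rw [Set.image_add_const_Ioc]
    ring_nf
  rw [h1, ← lintegral_tsum (fun n => by have := FF_measurable; fun_prop)]
  have h2 : ∫⁻ x in Set.Ioc (0 : ℝ) 1, ∑' n : ℤ, ENNReal.ofReal (FF (x + n)) =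
      ∫⁻ x in Set.Ioc (0 : ℝ) 1, ENNReal.ofReal (1/2 * (x - 1/2)^2) := by
    refine setLIntegral_congr_fun measurableSet_Ioc fun x hx => ?_
    have := FF_hasSum hx
    rw [← ENNReal.ofReal_tsum_of_nonneg (fun n => FF_nonneg _) this.summable, this.tsum_eq]
  rw [h2, ← integral_eq_lintegral_of_nonneg_ae (Filter.Eventually.of_forall fun x => by positivity)
    (Continuous.aestronglyMeasurable (by fun_prop)), ← intervalIntegral.integral_of_le zero_le_one]
  rw [intervalIntegral.integral_const_mul, intervalIntegral.integral_comp_sub_right (fun x => x^2),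
    integral_pow]
  norm_num

theorem stmt19 :
    (∀ x : ℝ, max 0 x ≤ V₀ x) ∧
      2 * ∫ x : ℝ, (V₀ x - max 0 x) = 1/12 := by
  refine ⟨fun x => ?_, ?_⟩
  · have := FF_nonneg x
    rw [← V_eq] at this
    linarith
  · simp_rw [V_eq]
    rw [FF_integral]
    norm_num
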